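/- Let n be a positive integer and let k be an integer with 1 ≤ k ≤ ⌊(n+1)/3⌋. Let S be a sequence in Z_n of length n − k such that 0 ∉ Σ(S). Then S is equivalent to a sequence (1^{n−2k+1}, x_1, x_2, …, x_{k−1}) with x̄_1 + … + x̄_{k−1} ≤ 2k − 2; that is, there exist an integer c coprime to n and an element x ∈ Z_n such that the multiset {c(a − x) : a a term of S} consists of the element 1 with multiplicity n − 2k + 1 together with elements x_1, …, x_{k−1} whose least positive representatives satisfy x̄_1 + … + x̄_{k−1} ≤ 2k − 2. -/

import Mathlib

/-- The least positive representative of `z : ZMod n`, lying in `{1, …, n}` (so `0̄ = n`). -/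
def barRep (n : ℕ) (z : ZMod n) : ℕ := if z = 0 then n else z.val

theorem exists_mem_forall_count_le {α : Type*} [DecidableEq α] {S : Multiset α} (hS : S ≠ 0) :
    ∃ a ∈ S, ∀ b, S.count b ≤ S.count a := by
  obtain ⟨a, ha, hmax⟩ := S.toFinset.exists_max_image (S.count ·) (by simpa using hS)
  refine ⟨a, by simpa using ha, fun b => ?_⟩
  by_cases hb : b ∈ S
  · exact hmax b (by simpa using hb)
  · simp [Multiset.count_eq_zero_of_notMem hb]

theorem Multiset.count_add_count_le_card {α : Type*} [DecidableEq α] (S : Multiset α) {a b : α}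
    (hab : a ≠ b) : S.count a + S.count b ≤ S.card := by
  induction S using Multiset.induction_on with
  | empty => simp
  | cons c S ih =>
    simp only [Multiset.count_cons, Multiset.card_cons]
    split_ifs <;> grind

section ZeroSumFree

open scoped Pointwise

variable {G : Type*} [AddCommGroup G]

/-- A multiset is zero-sum free if it has no nonempty zero-sum submultiset. -/
def ZeroSumFree (S : Multiset G) : Prop := ∀ T ≤ S, T ≠ 0 → T.sum ≠ 0

theorem ZeroSumFree.mono {S T : Multiset G} (h : ZeroSumFree T) (hST : S ≤ T) :
    ZeroSumFree S := fun U hU => h U (hU.trans hST)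

theorem ZeroSumFree.ne_zero {S : Multiset G} (h : ZeroSumFree S) {a : G} (ha : a ∈ S) :
    a ≠ 0 := by
  simpa using h {a} (by simpa using ha) (by simp)

variable [DecidableEq G]

/-- **Scherk's theorem**: if `0` has only the trivial representation in `A + B`, then
`|A + B| ≥ |A| + |B| - 1`. -/
theorem card_add_card_le_card_add_add_one (A B : Finset G) (hA : 0 ∈ A) (hB : 0 ∈ B)
    (h : ∀ a ∈ A, ∀ b ∈ B, a + b = 0 → b = 0) : A.card + B.card ≤ (A + B).card + 1 := by
  induction hN : B.card using Nat.strong_induction_on generalizing A B with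
  | _ N ih =>
    subst hN
    by_cases hsub : ∀ e ∈ A, ∀ b ∈ B, e + b ∈ A
    · have hB1 : B ⊆ {0} := by
        intro b hb
        have himg : A.image (· + b) = A := by
          apply Finset.eq_of_subset_of_card_le
          · intro y hy
            obtain ⟨e, he, rfl⟩ := Finset.mem_image.1 hy
            exact hsub e he b hb
          · rw [Finset.card_image_of_injective _ (add_left_injective b)]
        have h0 : (0 : G) ∈ A.image (· + b) := by rwa [himg]
        obtain ⟨e, he, heb⟩ := Finset.mem_image.1 h0
        exact Finset.mem_singleton.2 (h e he b hb heb)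
      have h1 := Finset.card_le_card hB1
      have h2 : A ⊆ A + B := fun e he => by
        simpa using Finset.add_mem_add he hB
      have h3 := Finset.card_le_card h2
      simp only [Finset.card_singleton] at h1
      omega
    · push Not at hsub
      obtain ⟨e, he, b₀, hb₀, hb₀A⟩ := hsub
      set A' := A ∪ B.image (e + ·) with hA'
      set B' := B.filter (e + · ∈ A) with hB'
      have hcard : A'.card + B'.card = A.card + B.card := by
        have h1 := Finset.card_union_add_card_inter A (B.image (e + ·))
        have h2 : A ∩ B.image (e + ·) = B'.image (e + ·) := by
          ext y
          simp only [hB', Finset.mem_inter, Finset.mem_image, Finset.mem_filter]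
          constructor
          · rintro ⟨hy, b, hb, rfl⟩
            exact ⟨b, ⟨hb, hy⟩, rfl⟩
          · rintro ⟨b, ⟨hb, hy⟩, rfl⟩
            exact ⟨hy, b, hb, rfl⟩
        rw [h2, Finset.card_image_of_injective _ (add_right_injective e),
          Finset.card_image_of_injective _ (add_right_injective e)] at h1
        exact h1
      have hlt : B'.card < B.card := by
        apply Finset.card_lt_card
        rw [Finset.ssubset_iff_of_subset (Finset.filter_subset _ _)]
        exact ⟨b₀, hb₀, fun hmem => hb₀A (Finset.mem_filter.1 hmem).2⟩
      have hle : A' + B' ⊆ A + B := by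
        intro y hy
        obtain ⟨u, hu, v, hv, rfl⟩ := Finset.mem_add.1 hy
        obtain ⟨hvB, hvA⟩ := Finset.mem_filter.1 hv
        rcases Finset.mem_union.1 hu with hu | hu
        · exact Finset.add_mem_add hu hvB
        · obtain ⟨b, hb, rfl⟩ := Finset.mem_image.1 hu
          exact Finset.mem_add.2 ⟨e + v, hvA, b, hb, by abel⟩
      have hrep : ∀ u ∈ A', ∀ v ∈ B', u + v = 0 → v = 0 := by
        intro u hu v hv huv
        obtain ⟨hvB, hvA⟩ := Finset.mem_filter.1 hv
        rcases Finset.mem_union.1 hu with hu | hu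
        · exact h u hu v hvB huv
        · obtain ⟨b, hb, rfl⟩ := Finset.mem_image.1 hu
          have hb0 : b = 0 := h (e + v) hvA b hb (by rw [← huv]; abel)
          exact h e he v hvB (by simpa [hb0] using huv)
      have := ih B'.card hlt A' B' (Finset.mem_union_left _ hA)
        (Finset.mem_filter.2 ⟨hB, by simpa using he⟩) hrep rfl
      have := Finset.card_le_card hle
      omega

/-- The set of all sums of (possibly empty) submultisets. -/
def subsums (S : Multiset G) : Finset G := (S.powerset.map Multiset.sum).toFinset

theorem mem_subsums {S : Multiset G} {x : G} : x ∈ subsums S ↔ ∃ T ≤ S, T.sum = x := by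
  simp [subsums]

theorem zero_mem_subsums (S : Multiset G) : (0 : G) ∈ subsums S :=
  mem_subsums.2 ⟨0, Multiset.zero_le _, rfl⟩

theorem add_subsums_subset (S T : Multiset G) : subsums S + subsums T ⊆ subsums (S + T) := by
  intro y hy
  obtain ⟨u, hu, v, hv, rfl⟩ := Finset.mem_add.1 hy
  obtain ⟨U, hU, rfl⟩ := mem_subsums.1 hu
  obtain ⟨V, hV, rfl⟩ := mem_subsums.1 hv
  exact mem_subsums.2 ⟨U + V, add_le_add hU hV, Multiset.sum_add U V⟩

theorem ZeroSumFree.card_subsums_add {S T : Multiset G} (h : ZeroSumFree (S + T)) :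
    (subsums S).card + (subsums T).card ≤ (subsums (S + T)).card + 1 := by
  refine (card_add_card_le_card_add_add_one _ _ (zero_mem_subsums S) (zero_mem_subsums T)
    ?_).trans (Nat.succ_le_succ (Finset.card_le_card (add_subsums_subset S T)))
  intro u hu v hv huv
  obtain ⟨U, hU, rfl⟩ := mem_subsums.1 hu
  obtain ⟨V, hV, rfl⟩ := mem_subsums.1 hv
  by_cases hV0 : V = 0
  · simp [hV0]
  · refine absurd ?_ (h (U + V) (add_le_add hU hV) (by simp [hV0]))
    rw [Multiset.sum_add, huv]

theorem ZeroSumFree.card_lt_card_subsums {S : Multiset G} (h : ZeroSumFree S) :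
    S.card + 1 ≤ (subsums S).card := by
  induction S using Multiset.induction_on with
  | empty => exact Finset.card_pos.2 ⟨0, zero_mem_subsums 0⟩
  | cons a S ih =>
    have h1 := ih (h.mono (Multiset.le_cons_self S a))
    have h2 : ZeroSumFree ({a} + S) := by simpa using h
    have h3 := h2.card_subsums_add
    have ha : a ≠ 0 := h.ne_zero (Multiset.mem_cons_self a S)
    have h4 : ({0, a} : Finset G) ⊆ subsums {a} := by
      intro y hy
      rcases Finset.mem_insert.1 hy with rfl | hy
      · exact zero_mem_subsums _
      · rw [Finset.mem_singleton.1 hy]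
        exact mem_subsums.2 ⟨{a}, le_rfl, by simp⟩
    have h5 := Finset.card_le_card h4
    rw [Finset.card_pair ha.symm] at h5
    rw [Multiset.singleton_add] at h3
    rw [Multiset.card_cons]
    omega

theorem ZeroSumFree.four_le_card_subsums_pair {a b : G} (h : ZeroSumFree {a, b})
    (hab : a ≠ b) : 4 ≤ (subsums ({a, b} : Multiset G)).card := by
  have ha : a ≠ 0 := h.ne_zero (by simp)
  have hb : b ≠ 0 := h.ne_zero (by simp)
  have hs : a + b ≠ 0 := by simpa using h {a, b} le_rfl (by simp)
  have hsub : ({0, a, b, a + b} : Finset G) ⊆ subsums {a, b} := by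
    intro y hy
    simp only [Finset.mem_insert, Finset.mem_singleton] at hy
    rcases hy with rfl | rfl | rfl | rfl
    · exact zero_mem_subsums _
    · exact mem_subsums.2 ⟨{y}, by simp, by simp⟩
    · exact mem_subsums.2 ⟨{y}, by simp, by simp⟩
    · exact mem_subsums.2 ⟨{a, b}, le_rfl, by simp⟩
  refine le_trans (le_of_eq ?_) (Finset.card_le_card hsub)
  have hcard : ({0, a, b, a + b} : Finset G).card = 4 := by
    rw [Finset.card_insert_of_notMem, Finset.card_insert_of_notMem,
      Finset.card_insert_of_notMem, Finset.card_singleton] <;> grind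
  exact hcard.symm

theorem ZeroSumFree.six_le_card_subsums_of_ne_add {a b c : G} (h : ZeroSumFree {a, b, c})
    (hab : a ≠ b) (hac : a ≠ c) (hbc : b ≠ c) (hc : c ≠ a + b) :
    6 ≤ (subsums ({a, b, c} : Multiset G)).card := by
  have ha0 : a ≠ 0 := h.ne_zero (by simp)
  have hb0 : b ≠ 0 := h.ne_zero (by simp)
  have hc0 : c ≠ 0 := h.ne_zero (by simp)
  have hle_ab : ({a, b} : Multiset G) ≤ {a, b, c} := by
    simp [Multiset.insert_eq_cons]
  have hle_bc : ({b, c} : Multiset G) ≤ {a, b, c} := by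
    simp [Multiset.insert_eq_cons, Multiset.le_cons_self]
  have hle_ac : ({a, c} : Multiset G) ≤ {a, b, c} := by
    simp [Multiset.insert_eq_cons, Multiset.le_cons_self]
  have hsab : a + b ≠ 0 := by simpa using h _ hle_ab (by simp)
  have hsbc : b + c ≠ 0 := by simpa using h _ hle_bc (by simp)
  have hsac : a + c ≠ 0 := by simpa using h _ hle_ac (by simp)
  have hs : a + (b + c) ≠ 0 := by simpa using h _ le_rfl (by simp)
  have hsub : ({0, a, b, a + b, c, a + (b + c)} : Finset G) ⊆ subsums {a, b, c} := by
    intro y hy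
    simp only [Finset.mem_insert, Finset.mem_singleton] at hy
    rcases hy with rfl | rfl | rfl | rfl | rfl | rfl
    · exact zero_mem_subsums _
    · exact mem_subsums.2 ⟨{y}, by simp, by simp⟩
    · exact mem_subsums.2 ⟨{y}, by simp, by simp⟩
    · exact mem_subsums.2 ⟨{a, b}, hle_ab, by simp⟩
    · exact mem_subsums.2 ⟨{y}, by simp, by simp⟩
    · exact mem_subsums.2 ⟨{a, b, c}, le_rfl, by simp⟩
  refine le_trans (le_of_eq ?_) (Finset.card_le_card hsub)
  have hcard : ({0, a, b, a + b, c, a + (b + c)} : Finset G).card = 6 := by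
    rw [Finset.card_insert_of_notMem, Finset.card_insert_of_notMem,
      Finset.card_insert_of_notMem, Finset.card_insert_of_notMem,
      Finset.card_insert_of_notMem, Finset.card_singleton] <;> grind
  exact hcard.symm

theorem ZeroSumFree.six_le_card_subsums_triple {a b c : G} (h : ZeroSumFree {a, b, c})
    (hab : a ≠ b) (hac : a ≠ c) (hbc : b ≠ c) :
    6 ≤ (subsums ({a, b, c} : Multiset G)).card := by
  by_cases hc : c = a + b
  · by_cases hb : b = a + c
    · have ha : a ≠ b + c := by
        intro ha
        have hs : a + (b + c) ≠ 0 := by simpa using h _ le_rfl (by simp)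
        apply hs
        grind
      have e : ({a, b, c} : Multiset G) = {b, c, a} := by
        simp only [Multiset.insert_eq_cons, ← Multiset.singleton_add]; abel
      rw [e] at h ⊢
      exact h.six_le_card_subsums_of_ne_add hbc hab.symm hac.symm ha
    · have e : ({a, b, c} : Multiset G) = {a, c, b} := by
        simp only [Multiset.insert_eq_cons, ← Multiset.singleton_add]; abel
      rw [e] at h ⊢
      exact h.six_le_card_subsums_of_ne_add hac hab hbc.symm hb
  · exact h.six_le_card_subsums_of_ne_add hab hac hbc hc

theorem ZeroSumFree.card_add_lt_card_subsums {S : Multiset G} (h : ZeroSumFree S) (q : ℕ)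
    (hq : 2 * q ≤ S.card) (hcount : ∀ a, S.count a + q ≤ S.card) :
    S.card + q + 1 ≤ (subsums S).card := by
  induction q generalizing S with
  | zero => simpa using h.card_lt_card_subsums
  | succ q ih =>
    obtain ⟨a, ha, hmax⟩ := exists_mem_forall_count_le (S := S) (by rintro rfl; simp at hq)
    obtain ⟨b, hb, hab⟩ : ∃ b ∈ S, a ≠ b := by
      by_contra! hall
      have := Multiset.count_eq_card.2 hall
      have := hcount a
      omega
    obtain ⟨T, rfl⟩ := Multiset.exists_cons_of_mem ha
    obtain ⟨T, rfl⟩ := Multiset.exists_cons_of_mem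
      ((Multiset.mem_cons.1 hb).resolve_left hab.symm)
    have hST : a ::ₘ b ::ₘ T = {a, b} + T := by
      simp [Multiset.insert_eq_cons]
    have hT : ∀ c, T.count c + q ≤ T.card := by
      intro c
      have hc := hcount c
      have hca := hmax c
      have hac : c ≠ a → T.count a + T.count c ≤ T.card :=
        fun hne => T.count_add_count_le_card hne.symm
      simp only [Multiset.count_cons, Multiset.card_cons] at hc hca hq
      split_ifs at hc hca <;> grind
    rw [hST] at h
    have h1 := ih (h.mono (Multiset.le_add_left _ _))
      (by simp only [Multiset.card_cons] at hq; omega) hT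
    have h2 := (h.mono (Multiset.le_add_right _ _)).four_le_card_subsums_pair hab
    have h3 := h.card_subsums_add
    rw [hST, Multiset.card_add, Multiset.card_pair]
    omega

/-- A long zero-sum free multiset has an element of large multiplicity. -/
theorem ZeroSumFree.exists_le_count [Fintype G] {S : Multiset G} (h : ZeroSumFree S) {k : ℕ}
    (hk1 : 1 ≤ k) (hk : 3 * k ≤ Fintype.card G + 1) (hcard : S.card + k = Fintype.card G) :
    ∃ a, Fintype.card G + 1 ≤ S.count a + 2 * k := by
  by_contra! hcount
  have hle : (subsums S).card ≤ Fintype.card G := Finset.card_le_univ _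
  by_cases h3 : 3 * k ≤ Fintype.card G
  · have := h.card_add_lt_card_subsums k (by omega) fun a => by have := hcount a; omega
    omega
  · obtain ⟨a, ha, hmax⟩ := exists_mem_forall_count_le (S := S)
      (by rintro rfl; rw [Multiset.card_zero] at hcard; omega)
    obtain ⟨b, hb, hab⟩ : ∃ b ∈ S, a ≠ b := by
      by_contra! hall
      have := Multiset.count_eq_card.2 hall
      have := hcount a
      have := Multiset.count_pos.2 ha
      omega
    obtain ⟨T, rfl⟩ := Multiset.exists_cons_of_mem ha
    obtain ⟨T, rfl⟩ := Multiset.exists_cons_of_mem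
      ((Multiset.mem_cons.1 hb).resolve_left hab.symm)
    have hca := hcount a
    have hcb := hcount b
    have habT := T.count_add_count_le_card hab
    simp only [Multiset.count_cons, Multiset.card_cons, hab, hab.symm, if_true, if_false]
      at hca hcb hcard
    obtain ⟨c, hc, hac, hbc⟩ : ∃ c ∈ T, a ≠ c ∧ b ≠ c := by
      by_contra! hall
      have hsub : T.card = T.count a + T.count b := by
        clear * - hall hab
        induction T using Multiset.induction_on with
        | empty => simp
        | cons c T ih =>
          have := ih fun d hd => hall d (Multiset.mem_cons_of_mem hd)
          have := hall c (Multiset.mem_cons_self c T)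
          simp only [Multiset.count_cons, Multiset.card_cons]
          split_ifs <;> grind
      omega
    obtain ⟨T, rfl⟩ := Multiset.exists_cons_of_mem hc
    have hST : a ::ₘ b ::ₘ c ::ₘ T = {a, b, c} + T := by
      simp [Multiset.insert_eq_cons]
    have hT : ∀ d, T.count d + (k - 2) ≤ T.card := by
      intro d
      have hd := hcount d
      have hda := hmax d
      have had : d ≠ a → T.count a + T.count d ≤ T.card :=
        fun hne => T.count_add_count_le_card hne.symm
      simp only [Multiset.count_cons, Multiset.card_cons] at hd hda hcard
      split_ifs at hd hda <;> grind
    rw [hST] at h hle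
    simp only [Multiset.card_cons] at hcard
    have h1 := (h.mono (Multiset.le_add_left _ _)).card_add_lt_card_subsums (k - 2)
      (by omega) hT
    have h2 := (h.mono (Multiset.le_add_right _ _)).six_le_card_subsums_triple hab hac hbc
    have h4 := h.card_subsums_add
    omega

/-- If `a` occurs often in a long zero-sum free multiset, all other terms are small positive
multiples of `a`. -/
theorem ZeroSumFree.exists_nsmul_eq [Fintype G] {a : G} {m : ℕ} {X : Multiset G}
    (h : ZeroSumFree (Multiset.replicate m a + X))
    (hcard : Fintype.card G ≤ 2 * m + X.card) {x : G} (hx : x ∈ X) :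
    ∃ j, 1 ≤ j ∧ j ≤ m ∧ j • a = x := by
  by_contra! hne
  obtain ⟨Y, rfl⟩ := Multiset.exists_cons_of_mem hx
  rw [Multiset.card_cons] at hcard
  have hS : Multiset.replicate m a + x ::ₘ Y = (x ::ₘ Multiset.replicate m a) + Y := by simp
  have hpos : ∀ j, 1 ≤ j → j ≤ m → j • a ≠ 0 := by
    intro j hj1 hjm
    simpa using h (Multiset.replicate j a)
      ((Multiset.replicate_le_replicate a |>.2 hjm).trans (Multiset.le_add_right _ _))
      (by rw [← Multiset.card_pos, Multiset.card_replicate]; omega)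
  rw [hS] at h
  have hxpos : ∀ j, j ≤ m → x + j • a ≠ 0 := by
    intro j hjm
    have hle : x ::ₘ Multiset.replicate j a ≤ (x ::ₘ Multiset.replicate m a) + Y :=
      (Multiset.cons_le_cons x (Multiset.replicate_le_replicate a |>.2 hjm)).trans
        (Multiset.le_add_right _ _)
    simpa using h _ hle (by simp)
  have hinj : ∀ i j, i < j → j ≤ m → i • a ≠ j • a := by
    intro i j hij hjm he
    apply hpos (j - i) (by omega) (by omega)
    rw [sub_nsmul a hij.le, he]
    abel
  have hinj' : Set.InjOn (fun i : ℕ => i • a) (Finset.range (m + 1)) := by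
    intro i hi j hj he
    simp only [Finset.coe_range, Set.mem_Iio] at hi hj
    rcases lt_trichotomy i j with hij | hij | hij
    · exact absurd he (hinj i j hij (by omega))
    · exact hij
    · exact absurd he.symm (hinj j i hij (by omega))
  set P := (Finset.range (m + 1)).image (fun i : ℕ => i • a) with hP
  have hPcard : P.card = m + 1 := by
    rw [hP, Finset.card_image_of_injOn hinj', Finset.card_range]
  have hdisj : Disjoint P (P.image (x + ·)) := by
    rw [Finset.disjoint_left]
    intro y hy hy'
    obtain ⟨z, hz, rfl⟩ := Finset.mem_image.1 hy'
    obtain ⟨j, hj, rfl⟩ := Finset.mem_image.1 hz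
    obtain ⟨i, hi, he⟩ := Finset.mem_image.1 hy
    simp only [Finset.mem_range] at hi hj
    rcases lt_or_ge j i with hji | hij
    · apply hne (i - j) (by omega) (by omega)
      rw [sub_nsmul a hji.le, he]
      abel
    · apply hxpos (j - i) (by omega)
      rw [sub_nsmul a hij, he]
      abel
  have hsub : P ∪ P.image (x + ·) ⊆ subsums (x ::ₘ Multiset.replicate m a) := by
    intro y hy
    rcases Finset.mem_union.1 hy with hy | hy
    · obtain ⟨i, hi, rfl⟩ := Finset.mem_image.1 hy
      simp only [Finset.mem_range] at hi
      exact mem_subsums.2 ⟨Multiset.replicate i a, (Multiset.replicate_le_replicate a |>.2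
        (by omega)).trans (Multiset.le_cons_self _ _), by simp⟩
    · obtain ⟨z, hz, rfl⟩ := Finset.mem_image.1 hy
      obtain ⟨i, hi, rfl⟩ := Finset.mem_image.1 hz
      simp only [Finset.mem_range] at hi
      exact mem_subsums.2 ⟨x ::ₘ Multiset.replicate i a, Multiset.cons_le_cons x
        (Multiset.replicate_le_replicate a |>.2 (by omega)), by simp⟩
  have h1 := Finset.card_le_card hsub
  rw [Finset.card_union_of_disjoint hdisj,
    Finset.card_image_of_injective _ (add_right_injective x), hPcard] at h1
  have h2 := (h.mono (Multiset.le_add_left _ _)).card_lt_card_subsums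
  have h3 := h.card_subsums_add
  have h4 := Finset.card_le_univ (subsums (x ::ₘ Multiset.replicate m a + Y))
  omega

end ZeroSumFree

theorem exists_le_sum_eq_nsmul {G : Type*} [AddCommGroup G] (a : G) (m : ℕ) (Y : Multiset ℕ)
    (hY : ∀ y ∈ Y, y ≤ m) (j : ℕ) (hj : j ≤ m + Y.sum) :
    ∃ T ≤ Multiset.replicate m a + Y.map (· • a), T.sum = j • a ∧ (j ≠ 0 → T ≠ 0) := by
  induction Y using Multiset.induction_on generalizing j with
  | empty =>
    refine ⟨Multiset.replicate j a, ?_, by simp, fun hj0 => ?_⟩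
    · simpa [Multiset.replicate_le_replicate] using hj
    · rw [← Multiset.card_pos, Multiset.card_replicate]; omega
  | cons y Y ih =>
    have ih' := ih fun z hz => hY z (Multiset.mem_cons_of_mem hz)
    rw [Multiset.sum_cons] at hj
    rw [Multiset.map_cons, Multiset.add_cons]
    by_cases hjM : j ≤ m + Y.sum
    · obtain ⟨T, hT, hsum, hT0⟩ := ih' j hjM
      exact ⟨T, hT.trans (Multiset.le_cons_self _ _), hsum, hT0⟩
    · have hym := hY y (Multiset.mem_cons_self y Y)
      obtain ⟨T, hT, hsum, -⟩ := ih' (j - y) (by omega)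
      refine ⟨(y • a) ::ₘ T, Multiset.cons_le_cons _ hT, ?_, by simp⟩
      rw [Multiset.sum_cons, hsum, ← add_nsmul]
      congr 1
      omega

theorem ZeroSumFree.lt_addOrderOf {G : Type*} [AddCommGroup G] [Finite G] {a : G} {m : ℕ}
    {Y : Multiset ℕ} (h : ZeroSumFree (Multiset.replicate m a + Y.map (· • a)))
    (hY : ∀ y ∈ Y, y ≤ m) : m + Y.sum < addOrderOf a := by
  by_contra! hle
  obtain ⟨T, hT, hsum, hT0⟩ := exists_le_sum_eq_nsmul a m Y hY _ hle
  exact h T hT (hT0 (addOrderOf_pos a).ne') (hsum.trans (addOrderOf_nsmul_eq_zero a))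

theorem ZMod.isUnit_of_addOrderOf_eq {n : ℕ} [NeZero n] {a : ZMod n} (h : addOrderOf a = n) :
    IsUnit a := by
  have hn : 0 < n := Nat.pos_of_ne_zero (NeZero.ne n)
  rw [← ZMod.natCast_zmod_val a] at h ⊢
  rw [ZMod.addOrderOf_coe _ hn.ne'] at h
  rw [ZMod.isUnit_iff_coprime, Nat.coprime_comm, Nat.Coprime]
  have hdvd := Nat.gcd_dvd_left n a.val
  have hmul := Nat.div_mul_cancel hdvd
  rw [h] at hmul
  exact Nat.eq_of_mul_eq_mul_left hn (by omega)

/-- Theorem 2.3: let `n` be positive, `1 ≤ k ≤ ⌊(n+1)/3⌋`, and `S` a sequence in `ZMod n` of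
length `n - k` with no nonempty zero-sum subsequence. Then `S` is equivalent to a sequence
`(1^{n-2k+1}, x_1, …, x_{k-1})` with `x̄_1 + ⋯ + x̄_{k-1} ≤ 2k - 2`: there exist an integer
`c` coprime to `n` and `x ∈ ZMod n` such that the multiset `{c (a - x) : a ∈ S}` consists of
`1` with multiplicity `n - 2k + 1` together with `k - 1` elements whose least positive
representatives sum to at most `2k - 2`. -/
theorem stmt_8 (n k : ℕ) (hn : 0 < n) (hk1 : 1 ≤ k) (hk : k ≤ (n + 1) / 3)
    (S : Multiset (ZMod n)) (hcard : Multiset.card S = n - k)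
    (hzs : ¬ ∃ T ≤ S, T ≠ 0 ∧ T.sum = 0) :
    ∃ (c : ℤ) (x : ZMod n) (X : Multiset (ZMod n)),
      Int.gcd c n = 1 ∧ Multiset.card X = k - 1 ∧
      (X.map (barRep n)).sum ≤ 2 * k - 2 ∧
      S.map (fun a => (c : ZMod n) * (a - x)) =
        Multiset.replicate (n - 2 * k + 1) (1 : ZMod n) + X := by
  have : NeZero n := ⟨hn.ne'⟩
  have hS : ZeroSumFree S := fun T hT hT0 hsum => hzs ⟨T, hT, hT0, hsum⟩
  have hG : Fintype.card (ZMod n) = n := ZMod.card n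
  obtain ⟨a, ha⟩ := hS.exists_le_count hk1 (by omega) (by omega)
  obtain ⟨X, rfl⟩ := Multiset.le_iff_exists_add.1
    (Multiset.le_count_iff_replicate_le.1 (show n - 2 * k + 1 ≤ S.count a by omega))
  rw [Multiset.card_add, Multiset.card_replicate] at hcard
  have hX : ∀ x ∈ X, ∃ j, 1 ≤ j ∧ j ≤ n - 2 * k + 1 ∧ j • a = x := fun x hx =>
    hS.exists_nsmul_eq (by omega) hx
  choose! f hf1 hfm hfa using hX
  have hYX : (X.map f).map (· • a) = X := by
    rw [Multiset.map_map]
    exact (Multiset.map_congr rfl hfa).trans (Multiset.map_id X)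
  have hord : n - 2 * k + 1 + (X.map f).sum < addOrderOf a := by
    apply ZeroSumFree.lt_addOrderOf
    · rwa [hYX]
    · intro y hy
      obtain ⟨x, hx, rfl⟩ := Multiset.mem_map.1 hy
      exact hfm x hx
  have hsum : X.card ≤ (X.map f).sum := by
    simpa using Multiset.card_nsmul_le_sum (s := X.map f) (a := 1) (by
      intro y hy
      obtain ⟨x, hx, rfl⟩ := Multiset.mem_map.1 hy
      exact hf1 x hx)
  have hordn : addOrderOf a = n := by
    obtain ⟨d, hd⟩ : addOrderOf a ∣ n := by simpa [hG] using addOrderOf_dvd_card (x := a)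
    have hd1 : d = 1 := by
      rcases Nat.lt_or_ge d 2 with h2 | h2
      · interval_cases d
        · omega
        · rfl
      · have := Nat.mul_le_mul_left (addOrderOf a) h2
        omega
    rw [hd1, mul_one] at hd
    exact hd.symm
  obtain ⟨u, rfl⟩ := ZMod.isUnit_of_addOrderOf_eq hordn
  have hcast : (((((u⁻¹ : (ZMod n)ˣ) : ZMod n).val : ℤ)) : ZMod n) = (u⁻¹ : (ZMod n)ˣ) := by
    simp
  refine ⟨(((u⁻¹ : (ZMod n)ˣ) : ZMod n).val : ℤ), 0,
    X.map fun x => ((u⁻¹ : (ZMod n)ˣ) : ZMod n) * x, ?_, ?_, ?_, ?_⟩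
  · rw [Int.gcd_natCast_natCast]
    exact ZMod.val_coe_unit_coprime u⁻¹
  · rw [Multiset.card_map]
    omega
  · have hbar : ∀ x ∈ X, barRep n (((u⁻¹ : (ZMod n)ˣ) : ZMod n) * x) = f x := by
      intro x hx
      have hlt : f x < n := by
        have := Multiset.single_le_sum (fun y _ => Nat.zero_le y) _
          (Multiset.mem_map_of_mem f hx)
        omega
      have hval : ((u⁻¹ : (ZMod n)ˣ) : ZMod n) * x = (f x : ZMod n) := by
        conv_lhs => rw [← hfa x hx]
        rw [nsmul_eq_mul, mul_left_comm, Units.inv_mul, mul_one]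
      have hpos := hf1 x hx
      rw [barRep, hval, ZMod.val_natCast_of_lt hlt, if_neg]
      rw [ZMod.natCast_eq_zero_iff]
      exact fun hdvd => absurd (Nat.le_of_dvd hpos hdvd) (by omega)
    rw [Multiset.map_map, Function.comp_def, Multiset.map_congr rfl hbar]
    omega
  · rw [hcast]
    simp
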